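/- Let (W,S) be an irreducible Coxeter system such that W is infinite and the canonical bilinear form is not positive semidefinite (i.e., W is non-spherical and non-affine). Let G be a finite index subgroup of W. Then the centralizer of G in W is trivial: Z_W(G) = {1}. -/

import Mathlib

/-!
Statement 17 (Proposition 6.4): Let (W,S) be an irreducible Coxeter system such that W is
infinite and the canonical bilinear form is not positive semidefinite (i.e., W is non-spherical
and non-affine). Let G be a finite index subgroup of W. Then Z_W(G) = {1}.
-/

noncomputable section

namespace CoxeterPaper

variable {B : Type*} {W : Type*} [Group W]

/-- The entry `⟨α_s, α_t⟩` of the canonical bilinear form: `-cos (π / m_{s,t})` if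
`m_{s,t} < ∞`, and `-1` if `m_{s,t} = ∞` (encoded by `M s t = 0`). -/
noncomputable def formEntry (M : CoxeterMatrix B) (s t : B) : ℝ :=
  if M s t = 0 then -1 else -Real.cos (Real.pi / (M s t : ℝ))

/-- The canonical bilinear form on `V = ⊕_{s ∈ S} ℝ α_s`, identified with `B → ℝ` via the
basis of simple roots. -/
noncomputable def canonicalForm [Fintype B] (M : CoxeterMatrix B) (x y : B → ℝ) : ℝ :=
  ∑ s, ∑ t, x s * y t * formEntry M s t

/-- The Coxeter graph of `M`: vertex set `B`, with `s, t` joined by an edge iff `m_{s,t} ≥ 3`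
(where `m_{s,t} = ∞` is encoded by `M s t = 0`). -/
def coxeterGraph (M : CoxeterMatrix B) : SimpleGraph B :=
  SimpleGraph.fromRel (fun s t => M s t = 0 ∨ 3 ≤ M s t)

open Module

section Reflection

variable {V : Type*} [AddCommGroup V] [Module ℝ V]

/-- The map `v ↦ v - 2 Φ(a, v) a`, which is the orthogonal reflection in `a` when `Φ(a, a) = 1`. -/
def refl (Φ : LinearMap.BilinForm ℝ V) (a : V) : End ℝ V :=
  LinearMap.id - ((2 : ℝ) • Φ a).smulRight a

variable {Φ : LinearMap.BilinForm ℝ V}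

lemma refl_apply (a v : V) : refl Φ a v = v - (2 * Φ a v) • a := by
  simp [refl]

lemma refl_self {a : V} (ha : Φ a a = 1) : refl Φ a a = -a := by
  rw [refl_apply, ha]; module

lemma refl_mul_self {a : V} (ha : Φ a a = 1) : refl Φ a * refl Φ a = 1 := by
  ext v
  simp only [End.mul_apply, refl_apply, map_sub, map_smul, ha, End.one_apply]
  module

lemma refl_isometry (hΦ : ∀ v w, Φ v w = Φ w v) {a : V} (ha : Φ a a = 1) (v w : V) :
    Φ (refl Φ a v) (refl Φ a w) = Φ v w := by
  simp only [refl_apply, map_sub, map_smul, LinearMap.sub_apply, LinearMap.smul_apply, ha,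
    smul_eq_mul, hΦ v a]
  ring

lemma refl_mul_refl_apply (a b v : V) :
    (refl Φ b * refl Φ a) v =
      v - (2 * Φ a v) • a + (4 * Φ a v * Φ b a - 2 * Φ b v) • b := by
  simp only [End.mul_apply, refl_apply, map_sub, map_smul]
  module

lemma trace_refl_mul_refl [Module.Finite ℝ V] (hΦ : ∀ v w, Φ v w = Φ w v)
    {a b : V} (ha : Φ a a = 1) (hb : Φ b b = 1) :
    LinearMap.trace ℝ V (refl Φ b * refl Φ a) = finrank ℝ V - 4 + 4 * Φ a b ^ 2 := by
  have : refl Φ b * refl Φ a = 1 - ((2 : ℝ) • Φ a).smulRight a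
      + ((4 * Φ b a) • Φ a - (2 : ℝ) • Φ b).smulRight b := by
    ext v
    rw [refl_mul_refl_apply]
    simp only [LinearMap.add_apply, LinearMap.sub_apply, LinearMap.smulRight_apply,
      LinearMap.smul_apply, smul_eq_mul, End.one_apply]
    module
  rw [this, map_add, map_sub, LinearMap.trace_one, LinearMap.trace_smulRight,
    LinearMap.trace_smulRight]
  simp only [LinearMap.sub_apply, LinearMap.smul_apply, smul_eq_mul, ha, hb, hΦ b a]
  ring

/-- The product of two reflections in unit vectors at angle `π - π / m` has order dividing `m`. -/
lemma refl_mul_refl_pow (hΦ : ∀ v w, Φ v w = Φ w v) {a b : V} (ha : Φ a a = 1) (hb : Φ b b = 1)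
    {m : ℕ} (hm : 2 ≤ m) (hab : Φ a b = -Real.cos (Real.pi / m)) :
    (refl Φ b * refl Φ a) ^ m = 1 := by
  have hba := hΦ b a
  rcases hm.eq_or_lt with rfl | hm
  · have h0 : Φ a b = 0 := by simp [hab]
    ext v
    rw [pow_two, End.mul_apply, refl_mul_refl_apply, refl_mul_refl_apply]
    simp only [map_add, map_sub, map_smul, smul_eq_mul, hba, h0, ha, hb, End.one_apply]
    module
  set θ := Real.pi / m with hθ
  set R := refl Φ b * refl Φ a with hR
  set d := Real.cos (2 * θ) with hd
  have hm0 : (0 : ℝ) < m := by positivity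
  have hθ0 : 0 < θ := by positivity
  have hθ2 : 2 * θ < Real.pi := by
    rw [hθ, ← mul_div_assoc, div_lt_iff₀ hm0]
    have : (3 : ℝ) ≤ m := by exact_mod_cast hm
    nlinarith [Real.pi_pos]
  have hsin : Real.sin (2 * θ) ≠ 0 := (Real.sin_pos_of_pos_of_lt_pi (by linarith) hθ2).ne'
  have hd1 : (2 - 2 * d) ≠ 0 := by
    have : d < 1 := by
      rw [hd, ← Real.cos_zero]
      exact Real.cos_lt_cos_of_nonneg_of_le_pi le_rfl hθ2.le (by linarith)
    linarith
  have hd2 : d = 2 * Φ a b ^ 2 - 1 := by rw [hd, Real.cos_two_mul, hab]; ring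
  set Q : End ℝ V := R ^ 2 - (2 * d) • R + 1 with hQ
  have hQa : Q a = 0 := by
    rw [hQ]
    simp only [LinearMap.add_apply, LinearMap.sub_apply, LinearMap.smul_apply, pow_two,
      End.mul_apply, End.one_apply, hR, refl_apply, map_sub, map_smul, ha, hb, hba, hd2]
    module
  have hQb : Q b = 0 := by
    rw [hQ]
    simp only [LinearMap.add_apply, LinearMap.sub_apply, LinearMap.smul_apply, pow_two,
      End.mul_apply, End.one_apply, hR, refl_apply, map_sub, map_smul, ha, hb, hba, hd2]
    module
  have hQR : Q * (R - 1) = 0 := by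
    ext v
    rw [End.mul_apply, LinearMap.sub_apply, hR, refl_mul_refl_apply, End.one_apply]
    simp only [map_sub, map_add, map_smul, hQa, hQb]
    simp
  have hRR : R ^ 2 * (R - 1) = ((2 * d) • R - 1) * (R - 1) := by
    have : R ^ 2 * (R - 1) - ((2 * d) • R - 1) * (R - 1) = Q * (R - 1) := by
      rw [hQ]; noncomm_ring
    rwa [hQR, sub_eq_zero] at this
  have hpow : ∀ k : ℕ, Real.sin (2 * θ) • (R ^ k * (R - 1)) =
      (Real.sin (2 * k * θ) • R - Real.sin (2 * k * θ - 2 * θ) • 1) * (R - 1) := by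
    intro k
    induction k with
    | zero => simp
    | succ k ih =>
      have h1 : Real.sin (2 * ((k + 1 : ℕ) : ℝ) * θ) =
          2 * d * Real.sin (2 * k * θ) - Real.sin (2 * k * θ - 2 * θ) := by
        have : 2 * ((k + 1 : ℕ) : ℝ) * θ = 2 * k * θ + 2 * θ := by push_cast; ring
        rw [this, Real.sin_add, Real.sin_sub]; ring
      have h2 : 2 * ((k + 1 : ℕ) : ℝ) * θ - 2 * θ = 2 * k * θ := by push_cast; ring
      rw [h2, h1, pow_succ', mul_assoc, ← mul_smul_comm, ih, ← mul_assoc, mul_sub R,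
        mul_smul_comm, mul_smul_comm, mul_one, ← pow_two, sub_mul, smul_mul_assoc, hRR]
      simp only [sub_mul, smul_mul_assoc, one_mul]
      module
  have hRm : R ^ m * (R - 1) = R - 1 := by
    have h := hpow m
    have h1 : 2 * (m : ℝ) * θ = 2 * Real.pi := by rw [hθ]; field_simp
    rw [h1, Real.sin_two_pi, Real.sin_two_pi_sub, zero_smul, zero_sub, neg_smul, neg_neg,
      smul_mul_assoc, one_mul] at h
    exact smul_right_injective _ hsin h
  have hgeom : (∑ i ∈ Finset.range m, R ^ i) * (R - 1) = R ^ m - 1 := geom_sum_mul R m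
  have hcomm : Commute Q (∑ i ∈ Finset.range m, R ^ i) := by
    refine Commute.sum_right _ _ _ fun i _ => Commute.pow_right ?_ i
    rw [hQ]
    exact (((Commute.refl R).pow_left 2).sub_left ((Commute.refl R).smul_left _)).add_left
      (Commute.one_left R)
  have h0 : Q * (R ^ m - 1) = 0 := by
    rw [← hgeom, ← mul_assoc, hcomm.eq, mul_assoc, hQR, mul_zero]
  have h1 : (R - 1) * (R ^ m - 1) = 0 := by
    have : (R - 1) * (R ^ m - 1) = R ^ m * (R - 1) - (R - 1) := by
      simp only [sub_mul, mul_sub, ← pow_succ', ← pow_succ, mul_one, one_mul]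
    rw [this, hRm, sub_self]
  have h2 : (2 - 2 * d) • (R ^ m - 1) = 0 := by
    have : Q = (R - (2 * d - 1) • 1) * (R - 1) + (2 - 2 * d) • 1 := by
      rw [hQ, sub_mul, mul_sub, smul_mul_assoc, one_mul, ← pow_two, mul_one]
      module
    rw [this, add_mul, mul_assoc, h1, mul_zero, zero_add, smul_mul_assoc, one_mul] at h0
    exact h0
  exact sub_eq_zero.1 ((smul_eq_zero.1 h2).resolve_left hd1)

lemma refl_mul_refl_pow_sub_mem (a b : V) (k : ℕ) (v : V) :
    ((refl Φ b * refl Φ a) ^ k) v - v ∈ Submodule.span ℝ {a, b} := by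
  induction k with
  | zero => simp
  | succ k ih =>
    rw [pow_succ', End.mul_apply, refl_mul_refl_apply, Submodule.mem_span_pair]
    obtain ⟨p, q, hpq⟩ := Submodule.mem_span_pair.1 ih
    rw [sub_eq_iff_eq_add.1 hpq.symm]
    exact ⟨p + -(2 * Φ a (p • a + q • b + v)), q + (4 * Φ a (p • a + q • b + v) * Φ b a -
      2 * Φ b (p • a + q • b + v)), by module⟩

/-- An isotropic vector of the plane spanned by unit vectors `a`, `b` is an eigenvector of the
product of the two reflections. -/
lemma refl_mul_refl_isotropic (hΦ : ∀ v w, Φ v w = Φ w v) {a b : V} (ha : Φ a a = 1)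
    (hb : Φ b b = 1) {κ κ' : ℝ} (hsum : κ + κ' = -2 * Φ a b) (hprod : κ * κ' = 1) :
    (refl Φ b * refl Φ a) (b + κ • a) = (κ' ^ 2) • (b + κ • a) := by
  have hba := hΦ b a
  obtain ⟨c, hc⟩ : ∃ c, Φ a b = c := ⟨_, rfl⟩
  have hκ : κ = -2 * c - κ' := by rw [← hc]; linarith
  have hq : κ' ^ 2 = -1 - 2 * c * κ' := by rw [hκ] at hprod; linarith
  rw [refl_mul_refl_apply]
  simp only [map_add, map_smul, smul_eq_mul, ha, hb, hba, hc, smul_add, smul_smul]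
  have h1 : κ - 2 * (c + κ * 1) = κ' ^ 2 * κ := by
    rw [pow_two, mul_assoc, mul_comm κ' κ, hprod, hκ]; ring
  have h2 : 1 + (4 * (c + κ * 1) * c - 2 * (1 + κ * c)) = κ' ^ 2 := by
    rw [hq, hκ]; ring
  rw [← h1, ← h2]
  module

lemma eq_smul_of_refl_mul_refl_eigen (hΦ : ∀ v w, Φ v w = Φ w v) {a b : V} (ha : Φ a a = 1)
    (hb : Φ b b = 1) {κ κ' : ℝ} (hsum : κ + κ' = -2 * Φ a b) (hprod : κ * κ' = 1)
    (hne : κ ≠ κ') {v : V} (hv : (refl Φ b * refl Φ a) v = (κ' ^ 2) • v) :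
    ∃ r : ℝ, v = r • (b + κ • a) := by
  have hκ'1 : κ' ^ 2 ≠ 1 := by
    intro h
    apply hne
    have : κ * κ' ^ 2 = κ' := by rw [pow_two, ← mul_assoc, hprod, one_mul]
    rwa [h, mul_one] at this
  have hsq : κ ^ 2 ≠ κ' ^ 2 := by
    intro h
    apply hκ'1
    have h3 : κ' ^ 2 * κ' ^ 2 = 1 := by
      nth_rewrite 1 [← h]; rw [← mul_pow, hprod, one_pow]
    nlinarith [sq_nonneg κ']
  have hspan : ∃ p q : ℝ, v = p • a + q • b := by
    have hmem := refl_mul_refl_pow_sub_mem (Φ := Φ) a b 1 v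
    rw [pow_one, hv] at hmem
    obtain ⟨p, q, hpq⟩ := Submodule.mem_span_pair.1 hmem
    have h1 : (κ' ^ 2 - 1) • v = p • a + q • b := by rw [hpq]; module
    refine ⟨(κ' ^ 2 - 1)⁻¹ * p, (κ' ^ 2 - 1)⁻¹ * q, ?_⟩
    rw [mul_smul, mul_smul, ← smul_add, ← h1, inv_smul_smul₀ (sub_ne_zero.2 hκ'1)]
  obtain ⟨p, q, rfl⟩ := hspan
  have hd : κ - κ' ≠ 0 := sub_ne_zero.2 hne
  obtain ⟨r, hr⟩ : ∃ r, r = (p - q * κ') / (κ - κ') := ⟨_, rfl⟩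
  have hdec : p • a + q • b = r • (b + κ • a) + (q - r) • (b + κ' • a) := by
    have : p = r * κ + (q - r) * κ' := by rw [hr]; field_simp; ring
    nth_rewrite 1 [this]
    module
  have hzero : (κ ^ 2 - κ' ^ 2) • ((q - r) • (b + κ' • a)) = 0 := by
    rw [hdec, map_add, map_smul, map_smul, refl_mul_refl_isotropic hΦ ha hb hsum hprod,
      refl_mul_refl_isotropic hΦ ha hb (by linarith) (by linarith : κ' * κ = 1)] at hv
    have := sub_eq_zero.2 hv
    rw [← this]
    module
  refine ⟨r, ?_⟩
  rw [hdec, (smul_eq_zero.1 hzero).resolve_left (sub_ne_zero.2 hsq), add_zero]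

/-- If `f` is a product of two reflections acting hyperbolically on their plane, and `f` commutes
with a power of its conjugate under another reflection, then the root of the latter is either
orthogonal to the isotropic vectors of the plane or contained in the plane. -/
lemma isotropic_orthogonal_or_mem_span (hΦ : ∀ v w, Φ v w = Φ w v) {a b c : V} (ha : Φ a a = 1)
    (hb : Φ b b = 1) (hc : Φ c c = 1) {κ κ' : ℝ} (hsum : κ + κ' = -2 * Φ a b)
    (hprod : κ * κ' = 1) (hne : κ ≠ κ') {k : ℕ} (hk : k ≠ 0)
    (hcomm : Commute (refl Φ b * refl Φ a)
      (refl Φ c * (refl Φ b * refl Φ a) ^ k * refl Φ c)) :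
    Φ c (b + κ • a) = 0 ∨ c ∈ Submodule.span ℝ {a, b} := by
  by_contra! hcon
  obtain ⟨h0, hmem⟩ := hcon
  set f := refl Φ b * refl Φ a with hf
  set g := refl Φ c with hg
  set e := b + κ • a with he
  have hfe : f e = (κ' ^ 2) • e := refl_mul_refl_isotropic hΦ ha hb hsum hprod
  have hfke : ∀ n : ℕ, (f ^ n) e = ((κ' ^ 2) ^ n) • e := by
    intro n
    induction n with
    | zero => simp
    | succ n ih => rw [pow_succ', End.mul_apply, ih, map_smul, hfe, smul_smul, ← pow_succ]
  have hee : Φ e e = 0 := by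
    simp only [he, map_add, map_smul, LinearMap.add_apply, LinearMap.smul_apply, smul_eq_mul, ha,
      hb, hΦ b a]
    have : κ' = -2 * Φ a b - κ := by linarith
    rw [this] at hprod
    linarith
  have hgg : ∀ v, g (g v) = v := fun v => by
    rw [← End.mul_apply, refl_mul_self hc, End.one_apply]
  have hgiso : ∀ v w, Φ (g v) (g w) = Φ v w := refl_isometry hΦ hc
  have hfiso : ∀ (n : ℕ) (v w : V), Φ ((f ^ n) v) ((f ^ n) w) = Φ v w := by
    intro n
    induction n with
    | zero => simp
    | succ n ih =>
      intro v w
      rw [pow_succ', End.mul_apply, End.mul_apply, hf, End.mul_apply, End.mul_apply,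
        refl_isometry hΦ hb, refl_isometry hΦ ha, ← hf, ih]
  obtain ⟨r, hr⟩ : ∃ r : ℝ, (g * f ^ k * g) e = r • e := by
    refine eq_smul_of_refl_mul_refl_eigen hΦ ha hb hsum hprod hne ?_
    rw [← hf, ← End.mul_apply, hcomm.eq, End.mul_apply, hfe, map_smul]
  have hbge : (g * f ^ k * g) (g e) = ((κ' ^ 2) ^ k) • g e := by
    rw [End.mul_apply, hgg, End.mul_apply, hfke, map_smul]
  have hge : Φ e (g e) ≠ 0 := by
    rw [hg, refl_apply, map_sub, map_smul, hee, hΦ e c, smul_eq_mul]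
    intro h
    apply h0
    have : Φ c e * Φ c e = 0 := by linarith
    exact mul_self_eq_zero.1 this
  have hr1 : r * (κ' ^ 2) ^ k = 1 := by
    have h := congrArg₂ (fun v w => Φ v w) hr hbge
    simp only [End.mul_apply, hgiso, hfiso, map_smul, LinearMap.smul_apply, smul_eq_mul] at h
    have : (r * (κ' ^ 2) ^ k - 1) * Φ e (g e) = 0 := by linarith
    linarith [(mul_eq_zero.1 this).resolve_right hge]
  have hrne : r ≠ 1 := by
    rintro rfl
    rw [one_mul, pow_eq_one_iff_of_nonneg (sq_nonneg _) hk] at hr1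
    apply hne
    have : κ * κ' ^ 2 = κ' := by rw [pow_two, ← mul_assoc, hprod, one_mul]
    rwa [hr1, mul_one] at this
  have hgmem : g e ∈ Submodule.span ℝ {a, b} := by
    have h := refl_mul_refl_pow_sub_mem (Φ := Φ) a b k (g e)
    have h1 : (f ^ k) (g e) = r • g e := by
      have := congrArg g hr
      rwa [End.mul_apply, End.mul_apply, hgg, map_smul] at this
    rw [← hf, h1] at h
    have h2 : r • g e - g e = (r - 1) • g e := by module
    rw [h2] at h
    exact (Submodule.smul_mem_iff _ (sub_ne_zero.2 hrne)).1 h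
  have hemem : e ∈ Submodule.span ℝ {a, b} :=
    Submodule.mem_span_pair.2 ⟨κ, 1, by rw [he]; module⟩
  apply hmem
  have h3 : e - g e = (2 * Φ c e) • c := by rw [hg, refl_apply]; module
  have h4 := Submodule.sub_mem _ hemem hgmem
  rw [h3] at h4
  exact (Submodule.smul_mem_iff _ (mul_ne_zero two_ne_zero h0)).1 h4

lemma orthogonal_or_mem_span (hΦ : ∀ v w, Φ v w = Φ w v) {a b c : V} (ha : Φ a a = 1)
    (hb : Φ b b = 1) (hc : Φ c c = 1) (hab : 1 < Φ a b ^ 2) {k : ℕ} (hk : k ≠ 0)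
    (hcomm : Commute (refl Φ b * refl Φ a)
      (refl Φ c * (refl Φ b * refl Φ a) ^ k * refl Φ c)) :
    (Φ c a = 0 ∧ Φ c b = 0) ∨ c ∈ Submodule.span ℝ {a, b} := by
  have hpos : 0 < Φ a b ^ 2 - 1 := by linarith
  set s := √(Φ a b ^ 2 - 1) with hs
  have hs0 : 0 < s := Real.sqrt_pos.2 hpos
  have hss : s ^ 2 = Φ a b ^ 2 - 1 := Real.sq_sqrt hpos.le
  by_cases hmem : c ∈ Submodule.span ℝ {a, b}
  · exact Or.inr hmem
  left
  have h1 := (isotropic_orthogonal_or_mem_span hΦ ha hb hc (κ := -Φ a b + s) (κ' := -Φ a b - s)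
    (by ring) (by linear_combination -hss) (by intro h; linarith) hk hcomm).resolve_right hmem
  have h2 := (isotropic_orthogonal_or_mem_span hΦ ha hb hc (κ := -Φ a b - s) (κ' := -Φ a b + s)
    (by ring) (by linear_combination -hss) (by intro h; linarith) hk hcomm).resolve_right hmem
  rw [map_add, map_smul, smul_eq_mul] at h1 h2
  have h3 : s * Φ c a = 0 := by linarith
  have h4 : Φ c a = 0 := (mul_eq_zero.1 h3).resolve_left hs0.ne'
  exact ⟨h4, by rw [h4] at h1; linarith⟩

end Reflection

section FormEntry

variable (M : CoxeterMatrix B)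

lemma formEntry_symm (s t : B) : formEntry M s t = formEntry M t s := by
  simp [formEntry, M.symmetric s t]

lemma formEntry_self (s : B) : formEntry M s s = 1 := by
  simp [formEntry]

lemma two_le_of_ne {s t : B} (hst : s ≠ t) (h0 : M s t ≠ 0) : 2 ≤ M s t := by
  have := M.off_diagonal s t hst
  omega

lemma formEntry_nonpos {s t : B} (hst : s ≠ t) : formEntry M s t ≤ 0 := by
  unfold formEntry
  split_ifs with h0
  · norm_num
  · have h2 : (2 : ℝ) ≤ M s t := by exact_mod_cast two_le_of_ne M hst h0
    rw [neg_nonpos]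
    apply Real.cos_nonneg_of_neg_pi_div_two_le_of_le
    · have : 0 ≤ Real.pi / (M s t : ℝ) := by positivity
      linarith [Real.pi_pos]
    · exact div_le_div_of_nonneg_left Real.pi_pos.le two_pos h2

lemma neg_one_le_formEntry (s t : B) : -1 ≤ formEntry M s t := by
  unfold formEntry
  split_ifs
  · exact le_rfl
  · exact neg_le_neg (Real.cos_le_one _)

lemma formEntry_neg_of_adj {s t : B} (h : (coxeterGraph M).Adj s t) : formEntry M s t < 0 := by
  rw [coxeterGraph, SimpleGraph.fromRel_adj, M.symmetric t s, or_self] at h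
  unfold formEntry
  split_ifs with h0
  · norm_num
  · have h3 : (3 : ℝ) ≤ M s t := by exact_mod_cast h.2.resolve_left h0
    rw [neg_lt_zero]
    apply Real.cos_pos_of_mem_Ioo
    constructor
    · have : 0 ≤ Real.pi / (M s t : ℝ) := by positivity
      linarith [Real.pi_pos]
    · exact div_lt_div_of_pos_left Real.pi_pos two_pos (by linarith)

end FormEntry

section SimpleRoot

variable [DecidableEq B]

/-- The simple root attached to `s`. -/
def simpleRoot (s : B) : B → ℝ := Pi.single s 1

lemma simpleRoot_nonneg (s : B) : (0 : B → ℝ) ≤ simpleRoot s :=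
  Pi.single_nonneg.2 zero_le_one

lemma simpleRoot_ne_zero (s : B) : (simpleRoot s : B → ℝ) ≠ 0 := by
  simp [simpleRoot]

end SimpleRoot

section Gram

variable [Fintype B] (M : CoxeterMatrix B)

/-- The canonical form as a bundled bilinear form. -/
def gramForm : LinearMap.BilinForm ℝ (B → ℝ) :=
  LinearMap.mk₂ ℝ (canonicalForm M)
    (fun x x' y => by simp only [canonicalForm, Pi.add_apply, add_mul, Finset.sum_add_distrib])
    (fun c x y => by
      simp only [canonicalForm, Pi.smul_apply, smul_eq_mul, Finset.mul_sum, mul_assoc])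
    (fun x y y' => by
      simp only [canonicalForm, Pi.add_apply, mul_add, add_mul, Finset.sum_add_distrib])
    (fun c x y => by
      simp only [canonicalForm, Pi.smul_apply, smul_eq_mul, Finset.mul_sum, mul_assoc,
        mul_left_comm])

lemma gramForm_apply (x y : B → ℝ) :
    gramForm M x y = ∑ s, ∑ t, x s * y t * formEntry M s t := rfl

lemma gramForm_symm (x y : B → ℝ) : gramForm M x y = gramForm M y x := by
  rw [gramForm_apply, gramForm_apply, Finset.sum_comm]
  refine Finset.sum_congr rfl fun s _ => Finset.sum_congr rfl fun t _ => ?_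
  rw [formEntry_symm]; ring

variable [DecidableEq B]

lemma gramForm_simpleRoot_right (x : B → ℝ) (s : B) :
    gramForm M x (simpleRoot s) = ∑ t, x t * formEntry M t s := by
  simp [gramForm_apply, simpleRoot, Pi.single_apply]

lemma gramForm_simpleRoot (s t : B) :
    gramForm M (simpleRoot s) (simpleRoot t) = formEntry M s t := by
  rw [gramForm_simpleRoot_right]
  simp [simpleRoot, Pi.single_apply]

lemma gramForm_simpleRoot_self (s : B) :
    gramForm M (simpleRoot s) (simpleRoot s) = 1 := by
  rw [gramForm_simpleRoot, formEntry_self]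

lemma eq_sum_simpleRoot (x : B → ℝ) : x = ∑ s, x s • simpleRoot s := by
  ext t
  simp [simpleRoot, Pi.single_apply]

variable {M}

lemma isLiftable_refl :
    M.IsLiftable fun s => refl (gramForm M) (simpleRoot s) := by
  intro s t
  rcases eq_or_ne s t with rfl | hst
  · rw [M.diagonal, pow_one, refl_mul_self (gramForm_simpleRoot_self M s)]
  by_cases h0 : M s t = 0
  · rw [h0, pow_zero]
  refine refl_mul_refl_pow (gramForm_symm M) (gramForm_simpleRoot_self M t)
    (gramForm_simpleRoot_self M s) (two_le_of_ne M hst h0) ?_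
  rw [gramForm_simpleRoot, formEntry_symm, formEntry, if_neg h0]

/-- The geometric representation of a Coxeter group. -/
def geomRep (cs : CoxeterSystem M W) : W →* End ℝ (B → ℝ) :=
  cs.lift ⟨_, isLiftable_refl⟩

variable (cs : CoxeterSystem M W)

lemma geomRep_simple (s : B) :
    geomRep cs (cs.simple s) = refl (gramForm M) (simpleRoot s) :=
  cs.lift_apply_simple _ s

lemma geomRep_simple_apply (s : B) (v : B → ℝ) :
    geomRep cs (cs.simple s) v = v - (2 * gramForm M (simpleRoot s) v) • simpleRoot s := by
  rw [geomRep_simple, refl_apply]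

lemma geomRep_isometry (w : W) : ∀ x y : B → ℝ,
    gramForm M (geomRep cs w x) (geomRep cs w y) = gramForm M x y := by
  induction w using cs.simple_induction_left with
  | one => simp
  | mul_simple_left w s ih =>
    intro x y
    rw [map_mul, End.mul_apply, End.mul_apply, geomRep_simple,
      refl_isometry (gramForm_symm M) (gramForm_simpleRoot_self M s), ih]

lemma geomRep_inv_apply (w : W) (v : B → ℝ) : geomRep cs w⁻¹ (geomRep cs w v) = v := by
  rw [← End.mul_apply, ← map_mul, inv_mul_cancel, map_one, End.one_apply]

lemma geomRep_injective (w : W) : Function.Injective (geomRep cs w) :=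
  Function.LeftInverse.injective (geomRep_inv_apply cs w)

lemma geomRep_conj_simple (w : W) (s : B) :
    geomRep cs (w * cs.simple s * w⁻¹) = refl (gramForm M) (geomRep cs w (simpleRoot s)) := by
  refine LinearMap.ext fun v => ?_
  obtain ⟨u, rfl⟩ : ∃ u, geomRep cs w u = v :=
    ⟨geomRep cs w⁻¹ v, by simpa only [inv_inv] using geomRep_inv_apply cs w⁻¹ v⟩
  rw [map_mul, map_mul, End.mul_apply, End.mul_apply, geomRep_inv_apply, geomRep_simple_apply,
    refl_apply, geomRep_isometry, map_sub, map_smul]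

end Gram

section Positivity

variable {M : CoxeterMatrix B} (cs : CoxeterSystem M W)

/-- Minimal representatives of cosets of rank two parabolic subgroups. -/
lemma exists_minimal_coset_rep (n : ℕ) : ∀ (w : W) (s t : B), cs.length w = n →
    cs.length w < cs.length (w * cs.simple s) →
    ∃ (v : W) (k : ℕ), w = v * cs.wordProd (CoxeterSystem.alternatingWord s t k) ∧
      cs.length w = cs.length v + k ∧ cs.length v < cs.length (v * cs.simple s) ∧
      cs.length v < cs.length (v * cs.simple t) := by
  induction n with
  | zero =>
    intro w s t hn hs
    obtain rfl := cs.length_eq_zero_iff.1 hn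
    exact ⟨1, 0, by simp [CoxeterSystem.alternatingWord], by simp, hs, by simp⟩
  | succ n ih =>
    intro w s t hn hs
    rcases cs.length_mul_simple w t with ht | ht
    · exact ⟨w, 0, by simp [CoxeterSystem.alternatingWord], by simp, hs, by omega⟩
    · obtain ⟨v, k, hv, hlen, h1, h2⟩ := ih (w * cs.simple t) t s (by omega)
        (by rw [cs.simple_mul_simple_cancel_right]; omega)
      refine ⟨v, k + 1, ?_, by omega, h2, h1⟩
      rw [CoxeterSystem.alternatingWord_succ, cs.wordProd_concat, ← mul_assoc, ← hv,
        cs.simple_mul_simple_cancel_right]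

lemma lt_of_minimal_coset_rep {w v : W} {s t : B} {k : ℕ} (h0 : M s t ≠ 0)
    (hs : cs.length w < cs.length (w * cs.simple s))
    (hw : w = v * cs.wordProd (CoxeterSystem.alternatingWord s t k))
    (hlen : cs.length w = cs.length v + k) : k < M s t := by
  by_contra! hk
  rcases hk.eq_or_lt with hk | hk
  · have h1 : w * cs.simple s =
        v * cs.wordProd (CoxeterSystem.alternatingWord s t (M s t * 2 - (k + 1))) := by
      have h2 : k + 1 ≤ M t s * 2 := by rw [M.symmetric t s]; omega
      have h3 := cs.prod_alternatingWord_eq_prod_alternatingWord_sub t s (k + 1) h2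
      rw [CoxeterSystem.alternatingWord_succ, cs.wordProd_concat, M.symmetric t s] at h3
      rw [hw, mul_assoc, h3]
    have h4 := cs.length_mul_le v
      (cs.wordProd (CoxeterSystem.alternatingWord s t (M s t * 2 - (k + 1))))
    have h5 := cs.length_wordProd_le (CoxeterSystem.alternatingWord s t (M s t * 2 - (k + 1)))
    rw [CoxeterSystem.length_alternatingWord] at h5
    rw [← h1] at h4
    omega
  · have h1 := cs.not_isReduced_alternatingWord s t h0 hk
    have h2 := cs.length_wordProd_le (CoxeterSystem.alternatingWord s t k)
    have h3 := cs.length_mul_le v (cs.wordProd (CoxeterSystem.alternatingWord s t k))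
    rw [CoxeterSystem.IsReduced] at h1
    rw [CoxeterSystem.length_alternatingWord] at h1 h2
    rw [← hw] at h3
    omega

variable [Fintype B] [DecidableEq B]

lemma geomRep_alternatingWord (s t : B) {u : ℕ → ℝ} (hu0 : u 0 = 0) (hu1 : u 1 = 1)
    (hu : ∀ k, u (k + 2) = -2 * formEntry M s t * u (k + 1) - u k) (k : ℕ) :
    geomRep cs (cs.wordProd (CoxeterSystem.alternatingWord s t k)) (simpleRoot s) =
      if Even k then u (k + 1) • simpleRoot s + u k • simpleRoot t
      else u k • simpleRoot s + u (k + 1) • simpleRoot t := by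
  induction k with
  | zero => simp [CoxeterSystem.alternatingWord, hu0, hu1]
  | succ k ih =>
    rw [CoxeterSystem.alternatingWord_succ', cs.wordProd_cons, map_mul, End.mul_apply, ih, hu k]
    by_cases hk : Even k
    · have hk' : ¬ Even (k + 1) := by simpa [parity_simps] using hk
      rw [if_pos hk, if_pos hk, if_neg hk', geomRep_simple_apply]
      simp only [map_add, map_smul, smul_eq_mul, gramForm_simpleRoot, formEntry_self,
        formEntry_symm M t s]
      module
    · have hk' : Even (k + 1) := by simpa [parity_simps] using hk
      rw [if_neg hk, if_neg hk, if_pos hk', geomRep_simple_apply]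
      simp only [map_add, map_smul, smul_eq_mul, gramForm_simpleRoot, formEntry_self]
      module

lemma exists_nonneg_geomRep_alternatingWord {s t : B} (hst : s ≠ t) {k : ℕ}
    (hk : M s t ≠ 0 → k < M s t) :
    ∃ p q : ℝ, 0 ≤ p ∧ 0 ≤ q ∧
      geomRep cs (cs.wordProd (CoxeterSystem.alternatingWord s t k)) (simpleRoot s) =
        p • simpleRoot s + q • simpleRoot t := by
  obtain ⟨u, hu0, hu1, hu, hk0, hk1⟩ : ∃ u : ℕ → ℝ, u 0 = 0 ∧ u 1 = 1 ∧
      (∀ k, u (k + 2) = -2 * formEntry M s t * u (k + 1) - u k) ∧ 0 ≤ u k ∧ 0 ≤ u (k + 1) := by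
    by_cases h0 : M s t = 0
    · refine ⟨fun k => k, by simp, by simp, fun k => ?_, by positivity, by positivity⟩
      rw [formEntry, if_pos h0]
      push_cast
      ring
    · have hm : (2 : ℝ) ≤ M s t := by exact_mod_cast two_le_of_ne M hst h0
      set θ := Real.pi / (M s t : ℝ) with hθ
      have hθ0 : 0 < θ := div_pos Real.pi_pos (by linarith)
      have hθm : (M s t : ℝ) * θ = Real.pi := by rw [hθ]; field_simp
      have hsin : 0 < Real.sin θ := Real.sin_pos_of_pos_of_lt_pi hθ0 (by nlinarith)
      have hnn : ∀ j : ℕ, j ≤ M s t → 0 ≤ Real.sin (j * θ) / Real.sin θ := by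
        intro j hj
        have hj' : (j : ℝ) ≤ M s t := by exact_mod_cast hj
        refine div_nonneg (Real.sin_nonneg_of_nonneg_of_le_pi (by positivity) ?_) hsin.le
        rw [← hθm]
        exact mul_le_mul_of_nonneg_right hj' hθ0.le
      refine ⟨fun j => Real.sin (j * θ) / Real.sin θ, by simp, ?_, fun j => ?_,
        hnn _ (hk h0).le, hnn _ (hk h0)⟩
      · simp [hsin.ne']
      · dsimp only
        rw [formEntry, if_neg h0, ← hθ]
        have h1 : ((j + 2 : ℕ) : ℝ) * θ = ((j + 1 : ℕ) : ℝ) * θ + θ := by push_cast; ring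
        have h2 : (j : ℝ) * θ = ((j + 1 : ℕ) : ℝ) * θ - θ := by push_cast; ring
        rw [h1, h2, Real.sin_add, Real.sin_sub]
        field_simp
        ring
  have h := geomRep_alternatingWord cs s t hu0 hu1 hu k
  split_ifs at h
  · exact ⟨_, _, hk1, hk0, h⟩
  · exact ⟨_, _, hk0, hk1, h⟩

/-- If `ℓ(ws) > ℓ(w)` then `w` sends the simple root of `s` to a positive root. -/
lemma geomRep_simpleRoot_nonneg (n : ℕ) : ∀ (w : W) (s : B), cs.length w = n →
    cs.length w < cs.length (w * cs.simple s) → 0 ≤ geomRep cs w (simpleRoot s) := by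
  induction n using Nat.strong_induction_on with
  | _ n ih =>
    intro w s hn hs
    by_cases hw : w = 1
    · rw [hw, map_one, End.one_apply]
      exact simpleRoot_nonneg s
    obtain ⟨t, ht⟩ := cs.exists_rightDescent_of_ne_one hw
    rw [CoxeterSystem.IsRightDescent] at ht
    have hst : s ≠ t := by rintro rfl; omega
    obtain ⟨v, k, hv, hlen, hvs, hvt⟩ := exists_minimal_coset_rep cs _ w s t rfl hs
    have hk : k ≠ 0 := by
      rintro rfl
      rw [CoxeterSystem.alternatingWord, cs.wordProd_nil, mul_one] at hv
      subst hv
      omega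
    obtain ⟨p, q, hp, hq, h⟩ := exists_nonneg_geomRep_alternatingWord cs hst
      (fun h0 => lt_of_minimal_coset_rep cs h0 hs hv hlen)
    rw [hv, map_mul, End.mul_apply, h, map_add, map_smul, map_smul]
    exact add_nonneg (smul_nonneg hp (ih _ (by omega) v s rfl hvs))
      (smul_nonneg hq (ih _ (by omega) v t rfl hvt))

/-- An element of the dual fundamental chamber is strictly increased by nontrivial elements. -/
lemma lt_geomRep_apply {x : B → ℝ} (hx : ∀ s, gramForm M x (simpleRoot s) < 0) (w : W) :
    x ≤ geomRep cs w x ∧ (w ≠ 1 → geomRep cs w x ≠ x) := by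
  obtain ⟨n, hn⟩ : ∃ n, cs.length w = n := ⟨_, rfl⟩
  induction n generalizing w with
  | zero =>
    obtain rfl := cs.length_eq_zero_iff.1 hn
    simp
  | succ n ih =>
    have hw : w ≠ 1 := by rintro rfl; simp at hn
    obtain ⟨s, hs⟩ := cs.exists_rightDescent_of_ne_one hw
    rw [cs.isRightDescent_iff] at hs
    obtain ⟨v, rfl⟩ : ∃ v, w = v * cs.simple s :=
      ⟨w * cs.simple s, by rw [cs.simple_mul_simple_cancel_right]⟩
    rw [cs.simple_mul_simple_cancel_right] at hs
    have hpos := geomRep_simpleRoot_nonneg cs _ v s rfl (by omega)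
    have hne : geomRep cs v (simpleRoot s) ≠ 0 := fun h =>
      simpleRoot_ne_zero s (geomRep_injective cs v (h.trans (map_zero _).symm))
    have hle := (ih v (by omega)).1
    have hc : 0 < -(2 * gramForm M (simpleRoot s) x) := by
      have := hx s
      rw [gramForm_symm] at this
      linarith
    have heq : geomRep cs (v * cs.simple s) x = geomRep cs v x +
        (-(2 * gramForm M (simpleRoot s) x)) • geomRep cs v (simpleRoot s) := by
      rw [map_mul, End.mul_apply, geomRep_simple_apply, map_sub, map_smul]
      module
    have hpos' := smul_nonneg hc.le hpos
    refine ⟨?_, fun _ h => ?_⟩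
    · rw [heq]
      exact le_add_of_le_of_nonneg hle hpos'
    · rw [heq] at h
      have h1 : (-(2 * gramForm M (simpleRoot s) x)) • geomRep cs v (simpleRoot s) ≤ 0 := by
        have := hle.trans_eq (eq_sub_of_add_eq h)
        exact (le_sub_self_iff x).1 this
      exact (smul_ne_zero hc.ne' hne) (le_antisymm h1 hpos')

end Positivity

section Irreducible

lemma forall_of_adj_of_connected {V : Type*} {Γ : SimpleGraph V} (hΓ : Γ.Connected) {P : V → Prop}
    (hP : ∀ s t, Γ.Adj s t → P s → P t) {s : V} (hs : P s) (t : V) : P t := by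
  obtain ⟨p⟩ := hΓ.preconnected s t
  induction p with
  | nil => exact hs
  | cons h _ ih => exact ih (hP _ _ h hs)

variable [Fintype B] [DecidableEq B] {M : CoxeterMatrix B}

/-- A negative Rayleigh quotient of minimal value is attained at a nonnegative eigenvector. -/
lemma exists_nonneg_eigenvector (hform : ¬ ∀ x : B → ℝ, 0 ≤ canonicalForm M x x) :
    ∃ (y : B → ℝ) (l : ℝ), 0 ≤ y ∧ y ≠ 0 ∧ l < 0 ∧
      ∀ s, gramForm M y (simpleRoot s) = l * y s := by
  push Not at hform
  obtain ⟨v, hv⟩ := hform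
  have hv0 : v ≠ 0 := by
    rintro rfl
    simp [canonicalForm] at hv
  have hdot : ∀ w : B → ℝ, w ≠ 0 → 0 < w ⬝ᵥ w := fun w hw => by
    refine lt_of_le_of_ne (Finset.sum_nonneg fun i _ => mul_self_nonneg _) fun h => hw ?_
    exact dotProduct_self_eq_zero.1 h.symm
  have hnorm : ∀ w : B → ℝ, w ≠ 0 → ((√(w ⬝ᵥ w))⁻¹ • w) ⬝ᵥ ((√(w ⬝ᵥ w))⁻¹ • w) = 1 := by
    intro w hw
    rw [smul_dotProduct, dotProduct_smul, smul_eq_mul, smul_eq_mul, ← mul_assoc, ← mul_inv,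
      Real.mul_self_sqrt (hdot w hw).le, inv_mul_cancel₀ (hdot w hw).ne']
  set K : Set (B → ℝ) := {w | w ⬝ᵥ w = 1} with hK
  have hcont : Continuous fun w : B → ℝ => gramForm M w w := by
    simp only [gramForm_apply]
    fun_prop
  have hcompact : IsCompact K := by
    refine IsCompact.of_isClosed_subset (isCompact_Icc (a := (-1 : B → ℝ)) (b := 1)) ?_ ?_
    · refine isClosed_eq ?_ continuous_const
      simp only [dotProduct]
      fun_prop
    · intro w hw
      have : ∀ i, w i * w i ≤ 1 := fun i => by
        rw [← show w ⬝ᵥ w = 1 from hw]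
        exact Finset.single_le_sum (f := fun j => w j * w j) (fun j _ => mul_self_nonneg _)
          (Finset.mem_univ i)
      exact ⟨fun i => (abs_le.1 (abs_le_one_iff_mul_self_le_one.2 (this i))).1,
        fun i => (abs_le.1 (abs_le_one_iff_mul_self_le_one.2 (this i))).2⟩
  obtain ⟨z, hzK, hz⟩ := hcompact.exists_isMinOn ⟨_, hnorm v hv0⟩ hcont.continuousOn
  set l := gramForm M z z with hl
  have hmin : ∀ w : B → ℝ, l * (w ⬝ᵥ w) ≤ gramForm M w w := by
    intro w
    rcases eq_or_ne w 0 with rfl | hw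
    · simp
    have h := hz (hnorm w hw)
    simp only [Set.mem_ofPred_eq, map_smul, LinearMap.smul_apply, smul_eq_mul] at h
    rw [← mul_assoc, ← mul_inv, Real.mul_self_sqrt (hdot w hw).le, inv_mul_eq_div,
      le_div_iff₀ (hdot w hw)] at h
    exact h
  have hl0 : l < 0 := by
    by_contra! h
    exact absurd hv (not_lt.2 ((mul_nonneg h (hdot v hv0).le).trans (hmin v)))
  have hyK : |z| ⬝ᵥ |z| = 1 := by
    rw [← show z ⬝ᵥ z = 1 from hzK]
    simp [dotProduct]
  have hyl : gramForm M |z| |z| ≤ l := by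
    rw [hl, gramForm_apply, gramForm_apply]
    refine Finset.sum_le_sum fun s _ => Finset.sum_le_sum fun t _ => ?_
    rcases eq_or_ne s t with rfl | hst
    · simp
    · refine mul_le_mul_of_nonpos_right ?_ (formEntry_nonpos M hst)
      rw [Pi.abs_apply, Pi.abs_apply, ← abs_mul]
      exact le_abs_self _
  refine ⟨|z|, l, abs_nonneg z, fun h => by simp [h] at hyK, hl0, fun s => ?_⟩
  have hquad : ∀ t : ℝ, 0 ≤ 2 * t * (gramForm M |z| (simpleRoot s) - l * |z| s) +
      t ^ 2 * (1 - l) := by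
    intro t
    have h := hmin (|z| + t • simpleRoot s)
    have h1 : (|z| + t • simpleRoot s) ⬝ᵥ (|z| + t • simpleRoot s) =
        1 + 2 * t * |z| s + t ^ 2 := by
      simp only [add_dotProduct, dotProduct_add, smul_dotProduct, dotProduct_smul, hyK, simpleRoot,
        dotProduct_single, single_dotProduct, smul_eq_mul, Pi.single_eq_same, Pi.add_apply,
        Pi.smul_apply]
      ring
    have h2 : gramForm M (|z| + t • simpleRoot s) (|z| + t • simpleRoot s) =
        gramForm M |z| |z| + 2 * t * gramForm M |z| (simpleRoot s) + t ^ 2 := by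
      simp only [map_add, map_smul, LinearMap.add_apply, LinearMap.smul_apply, smul_eq_mul,
        gramForm_simpleRoot_self, gramForm_symm M (simpleRoot s) |z|]
      ring
    rw [h1, h2] at h
    nlinarith
  set a := gramForm M |z| (simpleRoot s) - l * |z| s with ha
  have hb : 0 < 1 - l := by linarith
  have h := hquad (-a / (1 - l))
  have h3 : 2 * (-a / (1 - l)) * a + (-a / (1 - l)) ^ 2 * (1 - l) = -(a ^ 2 / (1 - l)) := by
    field_simp
    ring
  rw [h3] at h
  have h4 : a ^ 2 / (1 - l) = 0 := le_antisymm (by linarith) (by positivity)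
  have h5 : a ^ 2 = 0 := (div_eq_zero_iff.1 h4).resolve_right hb.ne'
  exact sub_eq_zero.1 (pow_eq_zero_iff two_ne_zero |>.1 h5)

/-- For an irreducible Coxeter matrix of indefinite type there is a vector with positive
coordinates which pairs negatively with all simple roots. -/
lemma exists_pos_pairing_neg (hirr : (coxeterGraph M).Connected)
    (hform : ¬ ∀ x : B → ℝ, 0 ≤ canonicalForm M x x) :
    ∃ x : B → ℝ, (∀ s, 0 < x s) ∧ ∀ s, gramForm M x (simpleRoot s) < 0 := by
  obtain ⟨y, l, hy, hy0, hl, heig⟩ := exists_nonneg_eigenvector hform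
  have hpos : ∀ s, 0 < y s := by
    intro s
    refine lt_of_le_of_ne (hy s) fun hs => hy0 ?_
    refine funext fun t => forall_of_adj_of_connected hirr (P := fun s => y s = 0) ?_ hs.symm t
    intro s t hst hs
    have h := heig s
    rw [hs, mul_zero, gramForm_simpleRoot_right] at h
    have hterm : ∀ r ∈ Finset.univ, y r * formEntry M r s ≤ 0 := by
      intro r _
      rcases eq_or_ne r s with rfl | hrs
      · simp [hs]
      · exact mul_nonpos_of_nonneg_of_nonpos (hy r) (formEntry_nonpos M hrs)
    have h0 := (Finset.sum_eq_zero_iff_of_nonpos hterm).1 h t (Finset.mem_univ t)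
    exact (mul_eq_zero.1 h0).resolve_right (formEntry_neg_of_adj M hst.symm).ne
  exact ⟨y, hpos, fun s => by rw [heig]; exact mul_neg_of_neg_of_pos hl (hpos s)⟩

/-- The geometric representation of an irreducible Coxeter group is absolutely simple. -/
lemma exists_eq_smul_one_of_commute (hirr : (coxeterGraph M).Connected)
    {T : End ℝ (B → ℝ)} (hT : ∀ s, Commute (refl (gramForm M) (simpleRoot s)) T) :
    ∃ l : ℝ, T = l • 1 := by
  have happ : ∀ s v, refl (gramForm M) (simpleRoot s) (T v) =
      T (refl (gramForm M) (simpleRoot s) v) := fun s v => by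
    rw [← End.mul_apply, (hT s).eq, End.mul_apply]
  have heig : ∀ s, T (simpleRoot s) =
      gramForm M (simpleRoot s) (T (simpleRoot s)) • simpleRoot s := by
    intro s
    have h := happ s (simpleRoot s)
    rw [refl_self (gramForm_simpleRoot_self M s), refl_apply, map_neg, mul_smul,
      sub_eq_iff_eq_add] at h
    have h2 : (2 : ℝ) • T (simpleRoot s) =
        (2 : ℝ) • gramForm M (simpleRoot s) (T (simpleRoot s)) • simpleRoot s := by
      rw [two_smul]
      nth_rewrite 1 [h]
      abel
    exact smul_right_injective _ two_ne_zero h2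
  choose c hc using fun s => (⟨_, heig s⟩ : ∃ c : ℝ, T (simpleRoot s) = c • simpleRoot s)
  have hadj : ∀ s t, (coxeterGraph M).Adj s t → c s = c t := by
    intro s t hst
    have h := happ s (simpleRoot t)
    rw [refl_apply, refl_apply, map_sub, map_smul, hc, hc, map_smul, gramForm_simpleRoot,
      smul_eq_mul] at h
    have h2 : (2 * formEntry M s t * (c s - c t)) • (simpleRoot s : B → ℝ) = 0 := by
      have := sub_eq_zero.2 h
      rw [← this]
      module
    have h3 := (smul_eq_zero.1 h2).resolve_right (simpleRoot_ne_zero s)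
    have h4 := (mul_eq_zero.1 h3).resolve_left
      (mul_ne_zero two_ne_zero (formEntry_neg_of_adj M hst).ne)
    exact sub_eq_zero.1 h4
  obtain ⟨s₀⟩ := hirr.nonempty
  have hconst : ∀ t, c t = c s₀ := fun t =>
    forall_of_adj_of_connected hirr (P := fun t => c t = c s₀)
      (fun s t hst hs => (hadj s t hst).symm.trans hs) rfl t
  refine ⟨c s₀, LinearMap.ext fun v => ?_⟩
  rw [eq_sum_simpleRoot v]
  simp only [map_sum, map_smul, hc, hconst, LinearMap.smul_apply, End.one_apply]

/-- The simple roots do not all lie in a plane if the form is of indefinite type. -/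
lemma two_lt_card (hirr : (coxeterGraph M).Connected)
    (hform : ¬ ∀ x : B → ℝ, 0 ≤ canonicalForm M x x) : 2 < Fintype.card B := by
  by_contra! hcard
  obtain ⟨x, hx, hneg⟩ := exists_pos_pairing_neg hirr hform
  have := hirr.nonempty
  obtain ⟨s, hs⟩ := Finite.exists_max x
  have h := hneg s
  rw [gramForm_simpleRoot_right, ← Finset.add_sum_erase _ _ (Finset.mem_univ s), formEntry_self,
    mul_one] at h
  have h1 : ∑ t ∈ Finset.univ.erase s, (-x s) ≤
      ∑ t ∈ Finset.univ.erase s, x t * formEntry M t s := by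
    refine Finset.sum_le_sum fun t _ => ?_
    nlinarith [neg_one_le_formEntry M t s, hs t, hx t]
  rw [Finset.sum_const, Finset.card_erase_of_mem (Finset.mem_univ s), Finset.card_univ,
    nsmul_eq_mul] at h1
  have h2 : ((Fintype.card B - 1 : ℕ) : ℝ) ≤ 1 := by exact_mod_cast (by omega)
  nlinarith [hx s]

/-- In a Coxeter group of irreducible indefinite type, nontrivial elements centralizing a normal
subgroup of finite index have large trace in the geometric representation. -/
lemma card_lt_trace (cs : CoxeterSystem M W)
    (hirr : (coxeterGraph M).Connected)
    (hform : ¬ ∀ x : B → ℝ, 0 ≤ canonicalForm M x x) (N : Subgroup W) [N.Normal]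
    [N.FiniteIndex] {z : W} (hz : z ∈ Subgroup.centralizer (N : Set W)) (hz1 : z ≠ 1) :
    (Fintype.card B : ℝ) < LinearMap.trace ℝ (B → ℝ) (geomRep cs z) := by
  obtain ⟨x, hx, hneg⟩ := exists_pos_pairing_neg hirr hform
  have : Fintype (W ⧸ N) := Fintype.ofFinite _
  have hconj : ∀ u v : W, (QuotientGroup.leftRel N) u v → u * z * u⁻¹ = v * z * v⁻¹ := by
    intro u v huv
    rw [QuotientGroup.leftRel_apply] at huv
    have h := Subgroup.mem_centralizer_iff.1 hz _ huv
    calc u * z * u⁻¹ = u * (z * (u⁻¹ * v)) * v⁻¹ := by group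
      _ = v * z * v⁻¹ := by rw [← h]; group
  set φ : W ⧸ N → W := Quotient.lift (fun u => u * z * u⁻¹) hconj with hφ
  have hφmk : ∀ u : W, φ (u : W ⧸ N) = u * z * u⁻¹ := fun u => rfl
  have hφsmul : ∀ (g : W) (q : W ⧸ N), φ (g • q) = g * φ q * g⁻¹ := by
    intro g q
    obtain ⟨u, rfl⟩ := QuotientGroup.mk_surjective q
    rw [MulAction.Quotient.smul_mk, hφmk, hφmk, smul_eq_mul]
    group
  set T : End ℝ (B → ℝ) := ∑ q : W ⧸ N, geomRep cs (φ q) with hT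
  have hcomm : ∀ g : W, geomRep cs g * T = T * geomRep cs g := by
    intro g
    rw [hT, Finset.mul_sum, Finset.sum_mul]
    rw [← Equiv.sum_comp (MulAction.toPerm g : Equiv.Perm (W ⧸ N))
      (fun q => geomRep cs (φ q) * geomRep cs g)]
    refine Finset.sum_congr rfl fun q _ => ?_
    rw [MulAction.toPerm_apply, hφsmul, ← map_mul, ← map_mul]
    group
  obtain ⟨l, hl⟩ := exists_eq_smul_one_of_commute hirr (T := T) fun s => by
    rw [← geomRep_simple cs]; exact hcomm _
  have htrφ : ∀ q, LinearMap.trace ℝ (B → ℝ) (geomRep cs (φ q)) =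
      LinearMap.trace ℝ (B → ℝ) (geomRep cs z) := by
    intro q
    obtain ⟨u, rfl⟩ := QuotientGroup.mk_surjective q
    rw [hφmk, map_mul, LinearMap.trace_mul_comm, ← map_mul]
    group
  set n : ℝ := (Fintype.card (W ⧸ N) : ℝ) with hn
  have htr : n * LinearMap.trace ℝ (B → ℝ) (geomRep cs z) = l * Fintype.card B := by
    have h : LinearMap.trace ℝ (B → ℝ) T = l * Fintype.card B := by
      rw [hl, map_smul, LinearMap.trace_one, Module.finrank_fintype_fun_eq_card, smul_eq_mul]
    rw [← h, hT, map_sum, Finset.sum_congr rfl fun q _ => htrφ q, Finset.sum_const,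
      Finset.card_univ, nsmul_eq_mul]
  have hTx : l • x = ∑ q : W ⧸ N, geomRep cs (φ q) x := by
    have := LinearMap.congr_fun hl x
    rw [LinearMap.smul_apply, End.one_apply, hT, LinearMap.sum_apply] at this
    exact this.symm
  have hlt : ∑ _q : W ⧸ N, x < ∑ q : W ⧸ N, geomRep cs (φ q) x := by
    refine Finset.sum_lt_sum (fun q _ => (lt_geomRep_apply cs hneg _).1)
      ⟨((1 : W) : W ⧸ N), Finset.mem_univ _, ?_⟩
    have h1 : φ ((1 : W) : W ⧸ N) = z := by rw [hφmk]; group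
    rw [h1]
    exact lt_of_le_of_ne (lt_geomRep_apply cs hneg z).1 ((lt_geomRep_apply cs hneg z).2 hz1).symm
  rw [Finset.sum_const, Finset.card_univ, ← hTx, Pi.lt_def] at hlt
  obtain ⟨-, s, hs⟩ := hlt
  rw [Pi.smul_apply, Pi.smul_apply, nsmul_eq_mul, smul_eq_mul] at hs
  have hnl : n < l := lt_of_mul_lt_mul_right hs (hx s).le
  have hn0 : 0 < n := by rw [hn]; exact_mod_cast Fintype.card_pos
  have hB : (0 : ℝ) < Fintype.card B := by
    have := hirr.nonempty
    exact_mod_cast Fintype.card_pos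
  have h : n * Fintype.card B < n * LinearMap.trace ℝ (B → ℝ) (geomRep cs z) := by
    rw [htr]
    exact mul_lt_mul_of_pos_right hnl hB
  exact lt_of_mul_lt_mul_left h hn0.le

/-- A normal subgroup of finite index has trivial centralizer. -/
lemma centralizer_normal_eq_bot (cs : CoxeterSystem M W)
    (hirr : (coxeterGraph M).Connected)
    (hform : ¬ ∀ x : B → ℝ, 0 ≤ canonicalForm M x x) (N : Subgroup W) [N.Normal]
    [N.FiniteIndex] : Subgroup.centralizer (N : Set W) = ⊥ := by
  rw [Subgroup.eq_bot_iff_forall]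
  intro z hz
  by_contra hz1
  by_cases hcen : ∀ s, Commute (cs.simple s) z
  · obtain ⟨l, hl⟩ := exists_eq_smul_one_of_commute hirr (T := geomRep cs z) fun s => by
      rw [← geomRep_simple cs]
      exact (hcen s).map (geomRep cs)
    have htr := card_lt_trace cs hirr hform N hz hz1
    rw [hl, map_smul, LinearMap.trace_one, Module.finrank_fintype_fun_eq_card, smul_eq_mul] at htr
    obtain ⟨s⟩ := hirr.nonempty
    have hiso := geomRep_isometry cs z (simpleRoot s) (simpleRoot s)
    simp only [hl, LinearMap.smul_apply, End.one_apply, map_smul, gramForm_simpleRoot_self,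
      smul_eq_mul, mul_one] at hiso
    have hB : (0 : ℝ) < Fintype.card B := by
      have : Nonempty B := ⟨s⟩
      exact_mod_cast Fintype.card_pos
    have hl1 : 1 < l := by
      by_contra! h
      nlinarith
    nlinarith
  · push Not at hcen
    obtain ⟨s, hs⟩ := hcen
    set a : B → ℝ := simpleRoot s with ha
    set b : B → ℝ := geomRep cs z a with hb
    have haa : gramForm M a a = 1 := gramForm_simpleRoot_self M s
    have hbb : gramForm M b b = 1 := by rw [hb, geomRep_isometry, haa]
    set f : W := z * cs.simple s * z⁻¹ * cs.simple s with hf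
    have hfmem : f ∈ Subgroup.centralizer (N : Set W) := by
      have h1 : cs.simple s * z⁻¹ * (cs.simple s)⁻¹ ∈ Subgroup.centralizer (N : Set W) :=
        Subgroup.Normal.conj_mem inferInstance _ (inv_mem hz) _
      rw [cs.inv_simple] at h1
      have h2 := mul_mem hz h1
      rwa [← mul_assoc, ← mul_assoc] at h2
    have hf1 : f ≠ 1 := by
      intro h
      apply hs
      have h2 : z * cs.simple s * z⁻¹ = cs.simple s := by
        rw [hf, mul_eq_one_iff_eq_inv, cs.inv_simple] at h
        exact h
      exact (mul_inv_eq_iff_eq_mul.1 h2).symm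
    have hrepf : geomRep cs f = refl (gramForm M) b * refl (gramForm M) a := by
      rw [hf, map_mul, geomRep_conj_simple, geomRep_simple]
    have hab : 1 < gramForm M a b ^ 2 := by
      have htr := card_lt_trace cs hirr hform N hfmem hf1
      rw [hrepf, trace_refl_mul_refl (gramForm_symm M) haa hbb,
        Module.finrank_fintype_fun_eq_card] at htr
      linarith
    have hdich : ∀ t, (gramForm M (simpleRoot t) a = 0 ∧ gramForm M (simpleRoot t) b = 0) ∨
        simpleRoot t ∈ Submodule.span ℝ {a, b} := by
      intro t
      refine orthogonal_or_mem_span (gramForm_symm M) haa hbb (gramForm_simpleRoot_self M t) hab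
        (Subgroup.FiniteIndex.index_ne_zero (H := N)) ?_
      have hmem : cs.simple t * f ^ N.index * cs.simple t ∈ N := by
        have := N.pow_index_mem (cs.simple t * f * (cs.simple t)⁻¹)
        rwa [conj_pow, cs.inv_simple] at this
      have hc : Commute f (cs.simple t * f ^ N.index * cs.simple t) :=
        (Subgroup.mem_centralizer_iff.1 hfmem _ hmem).symm
      have := hc.map (geomRep cs)
      rwa [map_mul _ (cs.simple t * f ^ N.index), map_mul _ (cs.simple t), map_pow, hrepf,
        geomRep_simple] at this
    have hall : ∀ t, simpleRoot t ∈ Submodule.span ℝ {a, b} := by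
      refine forall_of_adj_of_connected hirr (P := fun t => simpleRoot t ∈ Submodule.span ℝ {a, b})
        ?_ (s := s) (Submodule.subset_span (by simp [ha]))
      intro t r htr ht
      refine (hdich r).resolve_left fun ⟨h1, h2⟩ => ?_
      obtain ⟨p, q, hpq⟩ := Submodule.mem_span_pair.1 ht
      have h3 := gramForm_simpleRoot M r t
      rw [← hpq, map_add, map_smul, map_smul, h1, h2, smul_zero, smul_zero, add_zero] at h3
      exact (formEntry_neg_of_adj M htr.symm).ne h3.symm
    have htop : Submodule.span ℝ {a, b} = ⊤ := by
      rw [eq_top_iff]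
      intro v _
      rw [eq_sum_simpleRoot v]
      exact Submodule.sum_mem _ fun t _ => Submodule.smul_mem _ _ (hall t)
    have hrank : Fintype.card B ≤ 2 := by
      rw [← Module.finrank_fintype_fun_eq_card ℝ, ← finrank_top, ← htop]
      exact (finrank_span_le_card ({a, b} : Set (B → ℝ))).trans (by
        rw [Set.toFinset_insert, Set.toFinset_singleton]
        exact Finset.card_le_two)
    exact absurd (two_lt_card hirr hform) (not_lt.2 hrank)

end Irreducible

/-- **Proposition 6.4.** In an irreducible, non-spherical, non-affine Coxeter
group `W`, the centralizer of any finite index subgroup is trivial. -/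
theorem centralizer_of_finiteIndex_subgroup_trivial
    [Fintype B] {M : CoxeterMatrix B} (cs : CoxeterSystem M W)
    (hirr : (coxeterGraph M).Connected) (hinf : Infinite W)
    (hform : ¬ ∀ x : B → ℝ, 0 ≤ canonicalForm M x x)
    (G : Subgroup W) (hG : G.FiniteIndex) :
    Subgroup.centralizer (G : Set W) = ⊥ := by
  classical
  have hle : Subgroup.centralizer (G : Set W) ≤ Subgroup.centralizer (G.normalCore : Set W) :=
    Subgroup.centralizer_le (SetLike.coe_subset_coe.2 G.normalCore_le)
  rw [centralizer_normal_eq_bot cs hirr hform G.normalCore] at hle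
  exact le_bot_iff.1 hle

end CoxeterPaper
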